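/- Suppose the (x¹,x²)-marginal of q is supported on the diagonal, so that one may write X = X¹ = X². Let F₁, …, F_r be finite-valued random variables jointly distributed with (X, Y¹, Y²) ∼ q such that the Markov chain Y¹ – (F₁,…,F_r, X) – Y² holds, and let R'₁, …, R'_r be positive reals with Σ_{i=1}^s R'_i > I(Y¹, Y²; F₁,…,F_s | X) for every 1 ≤ s ≤ r. Then the rate pair (Σ_{i odd} R'_i, Σ_{i even} R'_i) is admissible for q with 2 interactive rounds of communication. -/

import Mathlib

open scoped BigOperators
open Finset

noncomputable section

namespace Coord

variable {Ω α β γ : Type*}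

/-- `p` is a probability mass function on the finite type `α`. -/
def IsPMF [Fintype α] (p : α → ℝ) : Prop := (∀ a, 0 ≤ p a) ∧ ∑ a, p a = 1

/-- ℓ¹ (total variation) distance between two functions on a finite type. -/
def l1dist [Fintype α] (p q : α → ℝ) : ℝ := ∑ a, |p a - q a|

/-- The distribution (pushforward pmf) of the random variable `X` defined on the
finite sample space `Ω` carrying the pmf `μ`. -/
def distr [Fintype Ω] [DecidableEq α] (μ : Ω → ℝ) (X : Ω → α) : α → ℝ :=
  fun a => ∑ ω, if X ω = a then μ ω else 0

/-- Shannon entropy (base 2) of a pmf. -/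
def entFun [Fintype α] (p : α → ℝ) : ℝ := - ∑ a, p a * Real.logb 2 (p a)

/-- Shannon entropy `H(X)` of a random variable `X` on `(Ω, μ)`. -/
def H [Fintype Ω] [Fintype α] [DecidableEq α] (μ : Ω → ℝ) (X : Ω → α) : ℝ :=
  entFun (distr μ X)

/-- Conditional entropy `H(X | Z)`. -/
def condEnt [Fintype Ω] [Fintype α] [Fintype γ] [DecidableEq α] [DecidableEq γ]
    (μ : Ω → ℝ) (X : Ω → α) (Z : Ω → γ) : ℝ :=
  H μ (fun ω => (X ω, Z ω)) - H μ Z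

/-- Mutual information `I(X; Y)`. -/
def mi [Fintype Ω] [Fintype α] [Fintype β] [DecidableEq α] [DecidableEq β]
    (μ : Ω → ℝ) (X : Ω → α) (Y : Ω → β) : ℝ :=
  H μ X + H μ Y - H μ (fun ω => (X ω, Y ω))

/-- Conditional mutual information `I(X; Y | Z)`. -/
def cmi [Fintype Ω] [Fintype α] [Fintype β] [Fintype γ]
    [DecidableEq α] [DecidableEq β] [DecidableEq γ]
    (μ : Ω → ℝ) (X : Ω → α) (Y : Ω → β) (Z : Ω → γ) : ℝ :=
  H μ (fun ω => (X ω, Z ω)) + H μ (fun ω => (Y ω, Z ω))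
    - H μ (fun ω => (X ω, Y ω, Z ω)) - H μ Z

variable {𝒳₁ 𝒳₂ 𝒴₁ 𝒴₂ : Type}

/-- The `(x¹, x²)`-marginal of `q(x¹, x², y¹, y²)`. -/
def srcMarg [Fintype 𝒴₁] [Fintype 𝒴₂] (q : 𝒳₁ × 𝒳₂ × 𝒴₁ × 𝒴₂ → ℝ) :
    𝒳₁ × 𝒳₂ → ℝ := fun x => ∑ y₁, ∑ y₂, q (x.1, x.2, y₁, y₂)

/-- The rate pair `(R12, R21)` is admissible for the coordination problem `q` with `r`
interactive rounds of communication: for every `ε > 0`, for all large enough block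
lengths `n`, there is a finite probability space carrying the i.i.d. sources, private
randomness `M₁, M₂`, interactive messages `C i` (messages with even Lean-index,
i.e. odd 1-based index, are sent by the first node), and outputs `Y₁, Y₂`,
meeting the rate constraints and approximating the i.i.d. target distribution
within total variation `ε`. -/
def Admissible [Fintype 𝒳₁] [Fintype 𝒳₂] [Fintype 𝒴₁] [Fintype 𝒴₂]
    [DecidableEq 𝒳₁] [DecidableEq 𝒳₂] [DecidableEq 𝒴₁] [DecidableEq 𝒴₂]
    (q : 𝒳₁ × 𝒳₂ × 𝒴₁ × 𝒴₂ → ℝ) (r : ℕ) (R12 R21 : ℝ) : Prop :=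
  ∀ ε : ℝ, 0 < ε → ∃ n₀ : ℕ, ∀ n : ℕ, n₀ ≤ n →
    ∃ (Ω 𝓜₁ 𝓜₂ : Type) (𝓒 : Fin r → Type)
      (_ : Fintype Ω) (_ : DecidableEq Ω)
      (_ : Fintype 𝓜₁) (_ : DecidableEq 𝓜₁)
      (_ : Fintype 𝓜₂) (_ : DecidableEq 𝓜₂)
      (_ : ∀ i, Fintype (𝓒 i)) (_ : ∀ i, DecidableEq (𝓒 i))
      (μ : Ω → ℝ)
      (X₁ : Ω → Fin n → 𝒳₁) (X₂ : Ω → Fin n → 𝒳₂)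
      (M₁ : Ω → 𝓜₁) (M₂ : Ω → 𝓜₂)
      (C : (i : Fin r) → Ω → 𝓒 i)
      (Y₁ : Ω → Fin n → 𝒴₁) (Y₂ : Ω → Fin n → 𝒴₂),
      IsPMF μ ∧
      -- the source pairs are i.i.d. with per-letter distribution the (x¹,x²)-marginal of q
      (distr μ (fun ω => (X₁ ω, X₂ ω)) =
        fun x => ∏ k, srcMarg q (x.1 k, x.2 k)) ∧
      -- M₁, M₂ and the sources are mutually independent
      (distr μ (fun ω => (M₁ ω, M₂ ω, X₁ ω, X₂ ω)) =
        fun m => distr μ M₁ m.1 * distr μ M₂ m.2.1 *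
          distr μ (fun ω => (X₁ ω, X₂ ω)) m.2.2) ∧
      -- messages with odd 1-based index are functions of (previous messages, X¹, M₁)
      (∀ i : Fin r, (i : ℕ) % 2 = 0 →
        condEnt μ (C i)
          (fun ω => ((fun j : Fin (i : ℕ) => C ⟨j.1, j.2.trans i.2⟩ ω), X₁ ω, M₁ ω)) = 0) ∧
      -- messages with even 1-based index are functions of (previous messages, X², M₂)
      (∀ i : Fin r, (i : ℕ) % 2 = 1 →
        condEnt μ (C i)
          (fun ω => ((fun j : Fin (i : ℕ) => C ⟨j.1, j.2.trans i.2⟩ ω), X₂ ω, M₂ ω)) = 0) ∧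
      -- rate constraints
      (∑ i ∈ Finset.univ.filter (fun i : Fin r => (i : ℕ) % 2 = 0), H μ (C i)) ≤ n * R12 ∧
      (∑ i ∈ Finset.univ.filter (fun i : Fin r => (i : ℕ) % 2 = 1), H μ (C i)) ≤ n * R21 ∧
      -- the outputs are produced from the locally available information
      condEnt μ Y₁ (fun ω => (X₁ ω, M₁ ω, fun i : Fin r => C i ω)) = 0 ∧
      condEnt μ Y₂ (fun ω => (X₂ ω, M₂ ω, fun i : Fin r => C i ω)) = 0 ∧
      -- total variation distance to the i.i.d. target is at most ε
      l1dist (distr μ (fun ω => (X₁ ω, X₂ ω, Y₁ ω, Y₂ ω)))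
        (fun a => ∏ k, q (a.1 k, a.2.1 k, a.2.2.1 k, a.2.2.2 k)) ≤ ε

section Distributions

theorem sum_distr_mul [Fintype Ω] [Fintype α] [DecidableEq α] (μ : Ω → ℝ) (X : Ω → α)
    (φ : α → ℝ) : ∑ a, distr μ X a * φ a = ∑ ω, μ ω * φ (X ω) := by
  simp only [distr, Finset.sum_mul]
  rw [Finset.sum_comm]
  simp [ite_mul]

theorem distr_nonneg [Fintype Ω] [DecidableEq α] {μ : Ω → ℝ} (hμ : ∀ ω, 0 ≤ μ ω)
    (X : Ω → α) (a : α) : 0 ≤ distr μ X a :=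
  Finset.sum_nonneg fun ω _ => by split_ifs <;> simp [hμ]

theorem le_distr [Fintype Ω] [DecidableEq α] {μ : Ω → ℝ} (hμ : ∀ ω, 0 ≤ μ ω)
    (X : Ω → α) (ω : Ω) : μ ω ≤ distr μ X (X ω) := by
  have h := Finset.single_le_sum (f := fun ω' => if X ω' = X ω then μ ω' else 0)
    (fun ω' _ => by split_ifs <;> simp [hμ]) (Finset.mem_univ ω)
  rwa [if_pos rfl] at h

theorem H_eq_sum [Fintype Ω] [Fintype α] [DecidableEq α] (μ : Ω → ℝ) (X : Ω → α) :
    H μ X = -∑ ω, μ ω * Real.logb 2 (distr μ X (X ω)) := by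
  rw [H, entFun, sum_distr_mul μ X fun a => Real.logb 2 (distr μ X a)]

theorem H_comp_of_injective [Fintype Ω] [Fintype α] [DecidableEq α] [Fintype β] [DecidableEq β]
    (μ : Ω → ℝ) (X : Ω → α) {e : α → β} (he : Function.Injective e) :
    H μ (fun ω => e (X ω)) = H μ X := by
  simp only [H_eq_sum, distr, he.eq_iff]

theorem condEnt_eq_zero_of_function [Fintype Ω] [Fintype α] [Fintype γ] [DecidableEq α]
    [DecidableEq γ] (μ : Ω → ℝ) (X : Ω → α) (Z : Ω → γ) (g : γ → α)
    (h : ∀ ω, X ω = g (Z ω)) : condEnt μ X Z = 0 := by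
  have : (fun ω => (X ω, Z ω)) = fun ω => (g (Z ω), Z ω) := by simp [h]
  rw [condEnt, this, H_comp_of_injective μ Z (e := fun z => (g z, z))
    (fun a b hab => (Prod.ext_iff.1 hab).2), sub_self]

/-- Conditional mutual information as the expectation of the information density. -/
theorem cmi_eq_sum [Fintype Ω] [Fintype α] [Fintype β] [Fintype γ]
    [DecidableEq α] [DecidableEq β] [DecidableEq γ] {μ : Ω → ℝ} (hμ : ∀ ω, 0 ≤ μ ω)
    (X : Ω → α) (Y : Ω → β) (Z : Ω → γ) :
    cmi μ X Y Z = ∑ ω, μ ω * Real.logb 2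
      ((distr μ (fun ω => (X ω, Y ω, Z ω)) (X ω, Y ω, Z ω) * distr μ Z (Z ω)) /
        (distr μ (fun ω => (X ω, Z ω)) (X ω, Z ω) *
          distr μ (fun ω => (Y ω, Z ω)) (Y ω, Z ω))) := by
  simp only [cmi, H_eq_sum, ← Finset.sum_neg_distrib, ← Finset.sum_add_distrib,
    ← Finset.sum_sub_distrib]
  refine Finset.sum_congr rfl fun ω _ => ?_
  rcases (hμ ω).eq_or_lt with h | h
  · simp [← h]
  · have h1 := h.trans_le (le_distr hμ (fun ω => (X ω, Y ω, Z ω)) ω)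
    have h2 := h.trans_le (le_distr hμ (fun ω => (X ω, Z ω)) ω)
    have h3 := h.trans_le (le_distr hμ (fun ω => (Y ω, Z ω)) ω)
    have h4 := h.trans_le (le_distr hμ Z ω)
    rw [Real.logb_div (by positivity) (by positivity), Real.logb_mul h1.ne' h4.ne',
      Real.logb_mul h2.ne' h3.ne']
    ring

theorem sum_distr_prod_left [Fintype Ω] [Fintype α] [DecidableEq α] [DecidableEq β] (μ : Ω → ℝ)
    (X : Ω → α) (Y : Ω → β) (y : β) :
    ∑ x, distr μ (fun ω => (X ω, Y ω)) (x, y) = distr μ Y y := by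
  simp only [distr, Prod.mk.injEq, ite_and]
  rw [Finset.sum_comm]
  simp

theorem eq_of_sub_sub_mul_log_eq_zero {a b : ℝ} (ha : 0 ≤ a) (hab : 0 < a → 0 < b)
    (h : b - a - a * Real.log (b / a) = 0) : a = b := by
  rcases ha.eq_or_lt with rfl | ha
  · simpa using h.symm
  · by_contra hne
    have hb := hab ha
    have h1 : Real.log (b / a) < b / a - 1 :=
      Real.log_lt_sub_one_of_pos (by positivity) fun h => hne (by field_simp at h; exact h.symm)
    have h2 := mul_lt_mul_of_pos_left h1 ha
    have h3 : a * (b / a - 1) = b - a := by field_simp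
    linarith

theorem sub_sub_mul_log_nonneg {a b : ℝ} (ha : 0 ≤ a) (hb : 0 ≤ b) (hab : 0 < a → 0 < b) :
    0 ≤ b - a - a * Real.log (b / a) := by
  rcases ha.eq_or_lt with rfl | ha
  · simpa using hb
  · have h1 := Real.log_le_sub_one_of_pos (div_pos (hab ha) ha)
    have h2 := mul_le_mul_of_nonneg_left h1 ha.le
    have h3 : a * (b / a - 1) = b - a := by field_simp
    linarith

/-- Vanishing conditional mutual information forces conditional independence. -/
theorem distr_mul_distr_of_cmi_eq_zero [Fintype Ω] [Fintype α] [Fintype β] [Fintype γ]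
    [DecidableEq α] [DecidableEq β] [DecidableEq γ] {μ : Ω → ℝ} (hμ : ∀ ω, 0 ≤ μ ω)
    (X : Ω → α) (Y : Ω → β) (Z : Ω → γ) (h : cmi μ X Y Z = 0) (x : α) (y : β) (z : γ) :
    distr μ (fun ω => (X ω, Y ω, Z ω)) (x, y, z) * distr μ Z z =
      distr μ (fun ω => (X ω, Z ω)) (x, z) * distr μ (fun ω => (Y ω, Z ω)) (y, z) := by
  set J := distr μ (fun ω => (X ω, Y ω, Z ω)) with hJ
  set A := distr μ (fun ω => (X ω, Z ω)) with hA
  set B := distr μ (fun ω => (Y ω, Z ω)) with hB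
  set D := distr μ Z with hD
  have J0 : ∀ a, 0 ≤ J a := distr_nonneg hμ _
  have A0 : ∀ a, 0 ≤ A a := distr_nonneg hμ _
  have B0 : ∀ a, 0 ≤ B a := distr_nonneg hμ _
  have D0 : ∀ a, 0 ≤ D a := distr_nonneg hμ _
  have hBJ : ∀ y z, ∑ x, J (x, y, z) = B (y, z) := fun y z =>
    sum_distr_prod_left μ X (fun ω => (Y ω, Z ω)) (y, z)
  have hAJ : ∀ x z, ∑ y, J (x, y, z) = A (x, z) := fun x z => by
    have := sum_distr_prod_left μ Y (fun ω => (X ω, Z ω)) (x, z)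
    rw [← hA] at this
    rw [← this]
    refine Finset.sum_congr rfl fun y _ => ?_
    simp only [hJ, distr, Prod.mk.injEq]
    refine Finset.sum_congr rfl fun ω _ => ?_
    congr 1
    exact propext and_left_comm
  have hDA : ∀ z, ∑ x, A (x, z) = D z := fun z => sum_distr_prod_left μ X Z z
  have hDB : ∀ z, ∑ y, B (y, z) = D z := fun z => sum_distr_prod_left μ Y Z z
  have leA : ∀ x y z, J (x, y, z) ≤ A (x, z) := fun x y z => by
    rw [← hAJ]
    exact Finset.single_le_sum (f := fun y => J (x, y, z)) (fun _ _ => J0 _) (Finset.mem_univ y)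
  have leB : ∀ x y z, J (x, y, z) ≤ B (y, z) := fun x y z => by
    rw [← hBJ]
    exact Finset.single_le_sum (f := fun x => J (x, y, z)) (fun _ _ => J0 _) (Finset.mem_univ x)
  have leD : ∀ x z, A (x, z) ≤ D z := fun x z => by
    rw [← hDA]
    exact Finset.single_le_sum (f := fun x => A (x, z)) (fun _ _ => A0 _) (Finset.mem_univ x)
  let u : α × β × γ → ℝ := fun a => A (a.1, a.2.2) * B (a.2.1, a.2.2) / D a.2.2
  have u0 : ∀ a, 0 ≤ u a := fun a => div_nonneg (mul_nonneg (A0 _) (B0 _)) (D0 _)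
  have upos : ∀ a, 0 < J a → 0 < u a := fun a ha => by
    have h1 := ha.trans_le (leA a.1 a.2.1 a.2.2)
    have h2 := ha.trans_le (leB a.1 a.2.1 a.2.2)
    have h3 := h1.trans_le (leD _ _)
    positivity
  have hsum : ∑ a, (u a - J a) = 0 := by
    have e : ∀ z, ∑ x, ∑ y, (u (x, y, z) - J (x, y, z)) = 0 := fun z => by
      have e1 : ∑ x, ∑ y, J (x, y, z) = D z := by simp only [hAJ, hDA]
      have e2 : ∑ x, ∑ y, u (x, y, z) = D z := by
        simp only [u, ← Finset.sum_div, ← Finset.mul_sum, ← Finset.sum_mul, hDA, hDB]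
        exact mul_self_div_self _
      simp only [Finset.sum_sub_distrib, e1, e2, sub_self]
    simp only [Fintype.sum_prod_type]
    calc ∑ x, ∑ y, ∑ z, (u (x, y, z) - J (x, y, z))
        = ∑ z, ∑ x, ∑ y, (u (x, y, z) - J (x, y, z)) := by
          rw [Finset.sum_congr rfl fun _ _ => Finset.sum_comm]
          exact Finset.sum_comm
      _ = 0 := by simp only [e, Finset.sum_const_zero]
  have hlog : ∑ a, J a * Real.log (u a / J a) = 0 := by
    have h' := (cmi_eq_sum hμ X Y Z).symm.trans h
    rw [← sum_distr_mul μ (fun ω => (X ω, Y ω, Z ω)) fun a => Real.logb 2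
      (J a * D a.2.2 / (A (a.1, a.2.2) * B (a.2.1, a.2.2)))] at h'
    have h2 : ∑ a, J a * Real.log (u a / J a) = -(Real.log 2 * ∑ a, J a * Real.logb 2
        (J a * D a.2.2 / (A (a.1, a.2.2) * B (a.2.1, a.2.2)))) := by
      rw [Finset.mul_sum, ← Finset.sum_neg_distrib]
      refine Finset.sum_congr rfl fun a _ => ?_
      have : u a / J a = (J a * D a.2.2 / (A (a.1, a.2.2) * B (a.2.1, a.2.2)))⁻¹ := by
        simp only [u, inv_div, div_div, mul_comm (D a.2.2)]
      have l2 : Real.log 2 ≠ 0 := (Real.log_pos one_lt_two).ne'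
      rw [this, Real.log_inv, Real.logb]
      field_simp
    rw [h2, h', mul_zero, neg_zero]
  have key : ∑ a, (u a - J a - J a * Real.log (u a / J a)) = 0 := by
    rw [Finset.sum_sub_distrib, hsum, hlog, sub_zero]
  rw [Finset.sum_eq_zero_iff_of_nonneg fun a _ =>
    sub_sub_mul_log_nonneg (J0 a) (u0 a) (upos a)] at key
  have heq := eq_of_sub_sub_mul_log_eq_zero (J0 _) (upos _) (key (x, y, z) (Finset.mem_univ _))
  rw [heq]
  simp only [u]
  refine div_mul_cancel_of_imp fun hz => ?_
  have : A (x, z) = 0 := le_antisymm ((leD x z).trans_eq hz) (A0 _)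
  rw [this, zero_mul]

end Distributions

section ProductSums

variable {ι : Type*} [Fintype ι] [DecidableEq ι]

theorem sum_prod_arrow [Fintype α] (f : ι → α → ℝ) :
    ∑ a : ι → α, ∏ i, f i (a i) = ∏ i, ∑ x, f i x := by
  rw [Finset.prod_univ_sum, Fintype.piFinset_univ]

theorem sum_arrow_prod {M : Type*} [AddCommMonoid M] [Fintype α] [Fintype β]
    (Φ : (ι → α) → (ι → β) → M) :
    ∑ c : ι → α × β, Φ (fun k => (c k).1) (fun k => (c k).2) = ∑ a, ∑ b, Φ a b := by
  rw [← Fintype.sum_prod_type' Φ]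
  exact Fintype.sum_equiv (Equiv.arrowProdEquivProdArrow ι (fun _ => α) (fun _ => β)) _ _
    fun _ => rfl

theorem sum_prod_mul_apply [Fintype α] {P : ι → α → ℝ} (hP : ∀ i, ∑ a, P i a = 1) (g : α → ℝ)
    (i : ι) : ∑ c : ι → α, (∏ j, P j (c j)) * g (c i) = ∑ a, P i a * g a := by
  have h : ∀ c : ι → α, (∏ j, P j (c j)) * g (c i) =
      ∏ j, (P j (c j) * if j = i then g (c j) else 1) := fun c => by
    rw [Finset.prod_mul_distrib]
    simp
  simp only [h]
  rw [sum_prod_arrow fun j a => P j a * if j = i then g a else 1, Finset.prod_eq_single i]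
  · simp
  · intro j _ hj
    simp [hj, hP]
  · simp

theorem sum_prod_mul_apply_mul_apply [Fintype α] {P g : α → ℝ} (hg : ∑ a, P a * g a = 0)
    {i j : ι} (hij : i ≠ j) : ∑ c : ι → α, (∏ k, P (c k)) * (g (c i) * g (c j)) = 0 := by
  have h : ∀ c : ι → α, (∏ k, P (c k)) * (g (c i) * g (c j)) =
      ∏ k, (P (c k) * ((if k = i then g (c k) else 1) * if k = j then g (c k) else 1)) :=
    fun c => by
      rw [Finset.prod_mul_distrib, Finset.prod_mul_distrib]
      simp
  simp only [h]
  rw [sum_prod_arrow fun k a => P a * ((if k = i then g a else 1) * if k = j then g a else 1)]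
  refine Finset.prod_eq_zero (Finset.mem_univ i) ?_
  simpa [hij] using hg

/-- The second moment of a sum of i.i.d. centred random variables. -/
theorem sum_prod_mul_sq_sum [Fintype α] {P g : α → ℝ} (hP : ∑ a, P a = 1)
    (hg : ∑ a, P a * g a = 0) :
    ∑ c : ι → α, (∏ k, P (c k)) * (∑ i, g (c i)) ^ 2 =
      Fintype.card ι * ∑ a, P a * g a ^ 2 := by
  have e : ∀ c : ι → α, (∏ k, P (c k)) * (∑ i, g (c i)) ^ 2 =
      ∑ i, ∑ j, (∏ k, P (c k)) * (g (c i) * g (c j)) := fun c => by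
    rw [sq, Finset.sum_mul_sum]
    simp only [Finset.mul_sum]
  simp only [e]
  rw [Finset.sum_comm]
  have h : ∀ i : ι, ∑ c : ι → α, ∑ j, (∏ k, P (c k)) * (g (c i) * g (c j)) =
      ∑ a, P a * g a ^ 2 := fun i => by
    rw [Finset.sum_comm, Finset.sum_eq_single i]
    · simp only [← sq]
      exact sum_prod_mul_apply (fun _ => hP) (fun a => g a ^ 2) i
    · intro j _ hj
      exact sum_prod_mul_apply_mul_apply hg hj.symm
    · simp
  simp only [h, Finset.sum_const, Finset.card_univ, nsmul_eq_mul, Finset.mul_sum]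

end ProductSums

section SoftCovering

theorem IsPMF.prod_arrow {ι : Type*} [Fintype ι] [DecidableEq ι] [Fintype α] {P : ι → α → ℝ}
    (hP : ∀ i, IsPMF (P i)) : IsPMF fun a : ι → α => ∏ i, P i (a i) :=
  ⟨fun a => Finset.prod_nonneg fun i _ => (hP i).1 _, by
    rw [sum_prod_arrow P]
    exact Finset.prod_eq_one fun i _ => (hP i).2⟩

theorem IsPMF.exists_le [Fintype α] {P : α → ℝ} (hP : IsPMF P) {L : α → ℝ} {B : ℝ}
    (h : ∑ a, P a * L a ≤ B) : ∃ a, L a ≤ B := by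
  by_contra! hB
  have h1 : ∑ a, P a * B < ∑ a, P a * L a := by
    refine Finset.sum_lt_sum (fun a _ => mul_le_mul_of_nonneg_left (hB a).le (hP.1 a)) ?_
    by_contra! h0
    have : ∑ a, P a = 0 := Finset.sum_eq_zero fun a ha => by
      have := h0 a ha
      by_contra hne
      have hpos := (hP.1 a).lt_of_ne' hne
      exact absurd (mul_lt_mul_of_pos_left (hB a) hpos) this.not_gt
    linarith [hP.2]
  rw [← Finset.sum_mul, hP.2, one_mul] at h1
  linarith

/-- One-shot soft covering: some codebook of size `|ι|` makes the output of the channel `W`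
under a uniformly chosen codeword close to the output `Q` under the input distribution `P`. -/
theorem exists_codebook {ι : Type*} [Fintype ι] [DecidableEq ι] [Nonempty ι] [Fintype α]
    [Fintype β] {P : α → ℝ} (hP : IsPMF P) {W : α → β → ℝ} (hW : ∀ a, IsPMF (W a))
    {Q : β → ℝ} (hQ : ∀ b, Q b = ∑ a, P a * W a b) {τ l : ℝ} (hτ : 0 ≤ τ) (hl : 0 < l) :
    ∃ c : ι → α, ∑ b, |(∑ i, W (c i) b) / Fintype.card ι - Q b| ≤
      l / 2 + τ / (2 * Fintype.card ι * l) +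
        2 * ∑ a, ∑ b, P a * W a b * (if τ * Q b < W a b then 1 else 0) := by
  set N : ℝ := (Fintype.card ι : ℝ) with hN
  have hNpos : 0 < N := by rw [hN]; exact_mod_cast Fintype.card_pos
  let w : (ι → α) → ℝ := fun c => ∏ i, P (c i)
  have hw : IsPMF w := IsPMF.prod_arrow fun _ => hP
  let V : α → β → ℝ := fun a b => W a b * (if τ * Q b < W a b then 1 else 0)
  let U : α → β → ℝ := fun a b => W a b - V a b
  have hQ0 : ∀ b, 0 ≤ Q b := fun b => by
    rw [hQ]; exact Finset.sum_nonneg fun a _ => mul_nonneg (hP.1 a) ((hW a).1 b)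
  have hV0 : ∀ a b, 0 ≤ V a b := fun a b => mul_nonneg ((hW a).1 b) (by split_ifs <;> simp)
  have hU0 : ∀ a b, 0 ≤ U a b := fun a b => by
    simp only [U, V]; split_ifs <;> simp [(hW a).1 b]
  have hUτ : ∀ a b, U a b ≤ τ * Q b := fun a b => by
    simp only [U, V]
    split_ifs with h
    · simpa using mul_nonneg hτ (hQ0 b)
    · simpa using h
  have hUW : ∀ a b, U a b ≤ W a b := fun a b => by simp only [U]; linarith [hV0 a b]
  let QU : β → ℝ := fun b => ∑ a, P a * U a b
  let QV : β → ℝ := fun b => ∑ a, P a * V a b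
  have hQV0 : ∀ b, 0 ≤ QV b := fun b => Finset.sum_nonneg fun a _ => mul_nonneg (hP.1 a) (hV0 a b)
  have hQsplit : ∀ b, Q b = QU b + QV b := fun b => by
    simp only [hQ, QU, QV, ← Finset.sum_add_distrib, U]
    exact Finset.sum_congr rfl fun a _ => by ring
  have hQsum : ∑ b, Q b = 1 := by
    simp only [hQ]
    rw [Finset.sum_comm]
    simp only [← Finset.mul_sum, (hW _).2, mul_one, hP.2]
  let g : β → α → ℝ := fun b a => U a b - QU b
  have hg : ∀ b, ∑ a, P a * g b a = 0 := fun b => by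
    simp only [g, mul_sub, Finset.sum_sub_distrib, ← Finset.sum_mul, hP.2, one_mul, QU, sub_self]
  have hg2 : ∀ b, ∑ a, P a * g b a ^ 2 ≤ τ * Q b * Q b := fun b => by
    have h1 : ∑ a, P a * g b a ^ 2 = ∑ a, P a * U a b ^ 2 - QU b ^ 2 := by
      have : ∀ a, P a * g b a ^ 2 =
          P a * U a b ^ 2 - 2 * QU b * (P a * U a b) + QU b ^ 2 * P a := fun a => by
        simp only [g]; ring
      simp only [this, Finset.sum_add_distrib, Finset.sum_sub_distrib, ← Finset.mul_sum, hP.2]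
      change _ - 2 * QU b * QU b + _ = _
      ring
    have h2 : ∑ a, P a * U a b ^ 2 ≤ τ * Q b * Q b := by
      conv_rhs => rw [hQ b, Finset.mul_sum, ← hQ b]
      refine Finset.sum_le_sum fun a _ => ?_
      have := mul_le_mul (hUτ a b) (hUW a b) (hU0 a b) (mul_nonneg hτ (hQ0 b))
      calc P a * U a b ^ 2 = P a * (U a b * U a b) := by ring
        _ ≤ P a * (τ * Q b * W a b) := mul_le_mul_of_nonneg_left this (hP.1 a)
        _ = _ := by ring
    linarith [sq_nonneg (QU b)]
  have hpt : ∀ (c : ι → α) b, |(∑ i, W (c i) b) / N - Q b| ≤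
      (l / 2 * Q b + (∑ i, g b (c i)) ^ 2 * (1 / (2 * l * N ^ 2) * (Q b)⁻¹)) +
        ((∑ i, V (c i) b) / N + QV b) := fun c b => by
    have h1 : (∑ i, W (c i) b) / N - Q b =
        (∑ i, g b (c i)) / N + ((∑ i, V (c i) b) / N - QV b) := by
      have : ∑ i, g b (c i) = ∑ i, W (c i) b - ∑ i, V (c i) b - N * QU b := by
        simp only [g, U, Finset.sum_sub_distrib, Finset.sum_const, Finset.card_univ,
          nsmul_eq_mul, hN]
      rw [this, hQsplit]
      field_simp
      ring
    have h2 : |(∑ i, V (c i) b) / N - QV b| ≤ (∑ i, V (c i) b) / N + QV b := by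
      have : 0 ≤ (∑ i, V (c i) b) / N :=
        div_nonneg (Finset.sum_nonneg fun i _ => hV0 _ _) hNpos.le
      rw [abs_le]
      constructor <;> linarith [hQV0 b]
    have h3 : |(∑ i, g b (c i)) / N| ≤
        l / 2 * Q b + (∑ i, g b (c i)) ^ 2 * (1 / (2 * l * N ^ 2) * (Q b)⁻¹) := by
      rcases (hQ0 b).eq_or_lt with h0 | hpos
      · have hU : ∀ a, U a b = 0 := fun a =>
          le_antisymm ((hUτ a b).trans (by rw [← h0, mul_zero])) (hU0 a b)
        simp [g, QU, hU, ← h0]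
      · set S := ∑ i, g b (c i)
        have e : l / 2 * Q b + S ^ 2 * (1 / (2 * l * N ^ 2) * (Q b)⁻¹) - |S / N| =
            (l * Q b - |S / N|) ^ 2 / (2 * l * Q b) := by
          have : S ^ 2 = N ^ 2 * |S / N| ^ 2 := by rw [sq_abs]; field_simp
          rw [this]
          field_simp
          ring
        have : 0 ≤ (l * Q b - |S / N|) ^ 2 / (2 * l * Q b) := by positivity
        linarith
    rw [h1]
    exact (abs_add_le _ _).trans (add_le_add h3 h2)
  have hEV : ∀ b, ∑ c : ι → α, w c * ((∑ i, V (c i) b) / N) = QV b := fun b => by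
    have : ∀ c : ι → α, w c * ((∑ i, V (c i) b) / N) = (∑ i, w c * V (c i) b) / N := fun c => by
      rw [← Finset.mul_sum, mul_div_assoc]
    simp only [this, ← Finset.sum_div]
    rw [Finset.sum_comm]
    simp only [w, sum_prod_mul_apply (fun _ => hP.2) (fun a => V a b)]
    rw [Finset.sum_const, Finset.card_univ, nsmul_eq_mul, ← hN]
    simp only [QV]
    field_simp
  have hEb : ∀ b, ∑ c, w c * |(∑ i, W (c i) b) / N - Q b| ≤
      (l / 2 + τ / (2 * N * l)) * Q b + 2 * QV b := fun b => by
    calc ∑ c, w c * |(∑ i, W (c i) b) / N - Q b|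
        ≤ ∑ c, w c * ((l / 2 * Q b + (∑ i, g b (c i)) ^ 2 * (1 / (2 * l * N ^ 2) * (Q b)⁻¹)) +
          ((∑ i, V (c i) b) / N + QV b)) :=
          Finset.sum_le_sum fun c _ => mul_le_mul_of_nonneg_left (hpt c b) (hw.1 c)
      _ = l / 2 * Q b + (∑ c, w c * (∑ i, g b (c i)) ^ 2) * (1 / (2 * l * N ^ 2) * (Q b)⁻¹) +
          2 * QV b := by
          have h2 := hEV b
          have : ∀ c : ι → α, w c * ((l / 2 * Q b + (∑ i, g b (c i)) ^ 2 *
              (1 / (2 * l * N ^ 2) * (Q b)⁻¹)) + ((∑ i, V (c i) b) / N + QV b)) =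
              w c * (l / 2 * Q b) + w c * (∑ i, g b (c i)) ^ 2 * (1 / (2 * l * N ^ 2) * (Q b)⁻¹)
                + w c * ((∑ i, V (c i) b) / N) + w c * QV b := fun c => by ring
          simp only [this, Finset.sum_add_distrib, h2, ← Finset.sum_mul, hw.2]
          ring
      _ = l / 2 * Q b + (N * ∑ a, P a * g b a ^ 2) * (1 / (2 * l * N ^ 2) * (Q b)⁻¹) +
          2 * QV b := by rw [sum_prod_mul_sq_sum hP.2 (hg b)]
      _ ≤ l / 2 * Q b + (N * (τ * Q b * Q b)) * (1 / (2 * l * N ^ 2) * (Q b)⁻¹) +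
          2 * QV b := by
          have := hQ0 b
          gcongr
          exact hg2 b
      _ = _ := by
          rcases eq_or_ne (Q b) 0 with h0 | h0
          · simp [h0]
          · field_simp
  refine hw.exists_le ?_
  calc ∑ c, w c * ∑ b, |(∑ i, W (c i) b) / N - Q b|
      = ∑ b, ∑ c, w c * |(∑ i, W (c i) b) / N - Q b| := by
        simp only [Finset.mul_sum]
        exact Finset.sum_comm
    _ ≤ ∑ b, ((l / 2 + τ / (2 * N * l)) * Q b + 2 * QV b) := Finset.sum_le_sum fun b _ => hEb b
    _ = _ := by
        rw [Finset.sum_add_distrib, ← Finset.mul_sum, ← Finset.mul_sum, hQsum, mul_one]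
        congr 2
        rw [Finset.sum_comm]
        simp only [V, mul_assoc]

end SoftCovering

section LargeDeviations

theorem exists_pos_sum_mul_exp_lt_one [Fintype α] {p : α → ℝ} (hp : IsPMF p) {v : α → ℝ}
    (hv : ∑ a, p a * v a < 0) : ∃ t : ℝ, 0 < t ∧ ∑ a, p a * Real.exp (t * v a) < 1 := by
  have hd : HasDerivAt (fun t : ℝ => ∑ a, p a * Real.exp (t * v a)) (∑ a, p a * v a) 0 := by
    refine HasDerivAt.fun_sum fun a _ => ?_
    have h := (((hasDerivAt_id (0 : ℝ)).mul_const (v a)).exp).const_mul (p a)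
    simpa using h
  have h1 := (hasDerivAt_iff_tendsto_slope.1 hd).eventually (gt_mem_nhds hv)
  have h2 : ∀ᶠ t : ℝ in nhdsWithin 0 (Set.Ioi 0),
      slope (fun t : ℝ => ∑ a, p a * Real.exp (t * v a)) 0 t < 0 :=
    h1.filter_mono (nhdsWithin_mono _ fun t (ht : 0 < t) => ht.ne')
  obtain ⟨t, ht, htpos⟩ := (h2.and self_mem_nhdsWithin).exists
  have htpos : 0 < t := htpos
  refine ⟨t, htpos, ?_⟩
  rw [slope_def_field] at ht
  simp only [zero_mul, Real.exp_zero, mul_one, hp.2, sub_zero] at ht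
  rw [div_lt_iff₀ htpos] at ht
  linarith

/-- Chernoff bound: a log-likelihood ratio of i.i.d. letters exceeds its mean linearly with
exponentially small probability. -/
theorem exists_chernoff_bound [Fintype α] {p u w : α → ℝ} (hp : IsPMF p)
    (hpos : ∀ a, 0 < p a → 0 < u a ∧ 0 < w a) {m : ℝ}
    (hm : ∑ a, p a * Real.log (u a / w a) < m) :
    ∃ ρ : ℝ, 0 ≤ ρ ∧ ρ < 1 ∧ ∀ n : ℕ, ∑ a : Fin n → α, (∏ k, p (a k)) *
      (if Real.exp (n * m) * ∏ k, w (a k) < ∏ k, u (a k) then 1 else 0) ≤ ρ ^ n := by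
  obtain ⟨t, ht, hlt⟩ := exists_pos_sum_mul_exp_lt_one hp
    (v := fun a => Real.log (u a / w a) - m) (by
      simp only [mul_sub, Finset.sum_sub_distrib, ← Finset.sum_mul, hp.2]
      linarith)
  refine ⟨_, Finset.sum_nonneg fun a _ => mul_nonneg (hp.1 a) (Real.exp_pos _).le, hlt,
    fun n => ?_⟩
  have e : (∑ a, p a * Real.exp (t * (Real.log (u a / w a) - m))) ^ n =
      ∑ a : Fin n → α, ∏ k, (p (a k) * Real.exp (t * (Real.log (u (a k) / w (a k)) - m))) := by
    rw [sum_prod_arrow fun _ a => p a * Real.exp (t * (Real.log (u a / w a) - m))]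
    simp
  rw [e]
  refine Finset.sum_le_sum fun a _ => ?_
  rw [Finset.prod_mul_distrib]
  by_cases h0 : ∀ k, 0 < p (a k)
  · refine mul_le_mul_of_nonneg_left ?_ (Finset.prod_nonneg fun k _ => hp.1 _)
    split_ifs with h
    · rw [← Real.exp_sum, ← Finset.mul_sum, Finset.sum_sub_distrib]
      refine Real.one_le_exp (mul_nonneg ht.le ?_)
      have hu : 0 < ∏ k, u (a k) := Finset.prod_pos fun k _ => (hpos _ (h0 k)).1
      have hw : 0 < ∏ k, w (a k) := Finset.prod_pos fun k _ => (hpos _ (h0 k)).2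
      have h1 : ∑ k, Real.log (u (a k) / w (a k)) =
          Real.log ((∏ k, u (a k)) / ∏ k, w (a k)) := by
        rw [← Finset.prod_div_distrib, Real.log_prod]
        exact fun k _ => (div_pos (hpos _ (h0 k)).1 (hpos _ (h0 k)).2).ne'
      have h2 : (n : ℝ) * m ≤ Real.log ((∏ k, u (a k)) / ∏ k, w (a k)) := by
        rw [Real.le_log_iff_exp_le (by positivity), le_div_iff₀ hw]
        exact h.le
      rw [h1]
      simpa using h2
    · exact Finset.prod_nonneg fun k _ => (Real.exp_pos _).le
  · push Not at h0
    obtain ⟨k, hk⟩ := h0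
    have : ∏ k, p (a k) = 0 :=
      Finset.prod_eq_zero (Finset.mem_univ k) (le_antisymm hk (hp.1 _))
    simp [this]

theorem exists_kernel [Fintype β] [Nonempty β] (J : α → β → ℝ) (hJ : ∀ a b, 0 ≤ J a b) :
    ∃ K : α → β → ℝ, (∀ a, IsPMF (K a)) ∧ ∀ a b, J a b = (∑ b', J a b') * K a b := by
  classical
  have h : ∀ a, ∃ K : β → ℝ, IsPMF K ∧ ∀ b, J a b = (∑ b', J a b') * K b := fun a => by
    by_cases h0 : ∑ b, J a b = 0
    · have hz := (Finset.sum_eq_zero_iff_of_nonneg fun b _ => hJ a b).1 h0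
      refine ⟨Pi.single (Classical.arbitrary β) 1,
        ⟨fun b => by rw [Pi.single_apply]; split_ifs <;> norm_num, by simp⟩, fun b => ?_⟩
      rw [h0, zero_mul, hz b (Finset.mem_univ b)]
    · refine ⟨fun b => J a b / ∑ b', J a b',
        ⟨fun b => div_nonneg (hJ a b) (Finset.sum_nonneg fun b _ => hJ a b), ?_⟩,
        fun b => (mul_div_cancel₀ _ h0).symm⟩
      rw [← Finset.sum_div, div_self h0]
  choose K hK using h
  exact ⟨K, fun a => (hK a).1, fun a => (hK a).2⟩

/-- Conditional soft covering for memoryless channels: codebooks of exponential rate exceeding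
the conditional mutual information approximate the output distribution. -/
theorem exists_block_codebook {F X Y : Type*} [Fintype F] [Fintype X] [Fintype Y]
    {π : X → ℝ} (hπ : IsPMF π) {P : X → F → ℝ} (hP : ∀ x, IsPMF (P x))
    {W : F → X → Y → ℝ} (hW : ∀ f x, IsPMF (W f x)) {Q : X → Y → ℝ}
    (hQ : ∀ x y, Q x y = ∑ f, P x f * W f x y) {R : ℝ}
    (hR : ∑ x, ∑ f, ∑ y, π x * P x f * W f x y * Real.log (W f x y / Q x y) < R)
    {ε : ℝ} (hε : 0 < ε) :
    ∃ n₀ : ℕ, ∀ n : ℕ, n₀ ≤ n → ∀ (ι : Type) [Fintype ι] [DecidableEq ι] [Nonempty ι],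
      Real.exp (n * R) / 4 ≤ Fintype.card ι →
      ∃ c : ι → (Fin n → X) → (Fin n → F),
        ∑ x : Fin n → X, (∏ k, π (x k)) * ∑ y : Fin n → Y,
          |(∑ i, ∏ k, W (c i x k) (x k) (y k)) / Fintype.card ι - ∏ k, Q (x k) (y k)| ≤ ε := by
  obtain ⟨m, hm, hmR⟩ := exists_between hR
  let p : X × F × Y → ℝ := fun a => π a.1 * P a.1 a.2.1 * W a.2.1 a.1 a.2.2
  have hp : IsPMF p := by
    refine ⟨fun a => mul_nonneg (mul_nonneg (hπ.1 _) ((hP _).1 _)) ((hW _ _).1 _), ?_⟩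
    simp only [p, Fintype.sum_prod_type, ← Finset.mul_sum, (hW _ _).2, (hP _).2, mul_one, hπ.2]
  have hQ0 : ∀ x y, 0 ≤ Q x y := fun x y => by
    rw [hQ]; exact Finset.sum_nonneg fun f _ => mul_nonneg ((hP x).1 f) ((hW f x).1 y)
  have hpos : ∀ a : X × F × Y, 0 < p a → 0 < W a.2.1 a.1 a.2.2 ∧ 0 < Q a.1 a.2.2 := by
    rintro ⟨x, f, y⟩ ha
    have hw : 0 < W f x y := ((hW _ _).1 _).lt_of_ne' fun h => by simp [p, h] at ha
    have hpf : 0 < P x f := ((hP _).1 _).lt_of_ne' fun h => by simp [p, h] at ha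
    refine ⟨hw, (mul_pos hpf hw).trans_le ?_⟩
    change _ ≤ Q x y
    rw [hQ]
    exact Finset.single_le_sum (f := fun f => P x f * W f x y)
      (fun f _ => mul_nonneg ((hP x).1 f) ((hW f x).1 y)) (Finset.mem_univ f)
  obtain ⟨ρ, hρ0, hρ1, hρ⟩ := exists_chernoff_bound hp
    (u := fun a => W a.2.1 a.1 a.2.2) (w := fun a => Q a.1 a.2.2) hpos (m := m)
    (by simpa only [p, Fintype.sum_prod_type] using hm)
  have t1 : Filter.Tendsto (fun n : ℕ => 4 / ε * Real.exp (m - R) ^ n) Filter.atTop (nhds 0) := by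
    simpa using (tendsto_pow_atTop_nhds_zero_of_lt_one (Real.exp_pos _).le
      (Real.exp_lt_one_iff.2 (by linarith : m - R < 0))).const_mul (4 / ε)
  have t2 : Filter.Tendsto (fun n : ℕ => 2 * ρ ^ n) Filter.atTop (nhds 0) := by
    simpa using (tendsto_pow_atTop_nhds_zero_of_lt_one hρ0 hρ1).const_mul 2
  have hε4 : 0 < ε / 4 := by positivity
  obtain ⟨n₀, hn₀⟩ := Filter.eventually_atTop.1
    ((t1.eventually (gt_mem_nhds hε4)).and (t2.eventually (gt_mem_nhds hε4)))
  refine ⟨n₀, fun n hn ι _ _ _ hcard => ?_⟩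
  obtain ⟨b1, b2⟩ := hn₀ n hn
  let bad : (Fin n → X) → ℝ := fun x => ∑ f : Fin n → F, ∑ y : Fin n → Y,
    (∏ k, P (x k) (f k)) * (∏ k, W (f k) (x k) (y k)) *
      (if Real.exp (n * m) * ∏ k, Q (x k) (y k) < ∏ k, W (f k) (x k) (y k) then 1 else 0)
  have hone : ∀ x : Fin n → X, ∃ c : ι → (Fin n → F), ∑ y : Fin n → Y,
      |(∑ i, ∏ k, W (c i k) (x k) (y k)) / Fintype.card ι - ∏ k, Q (x k) (y k)| ≤
        (ε / 2) / 2 + Real.exp (n * m) / (2 * Fintype.card ι * (ε / 2)) + 2 * bad x := by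
    intro x
    have hQn : ∀ y : Fin n → Y, ∏ k, Q (x k) (y k) =
        ∑ f : Fin n → F, (∏ k, P (x k) (f k)) * ∏ k, W (f k) (x k) (y k) := fun y => by
      simp only [hQ, ← Finset.prod_mul_distrib]
      exact (sum_prod_arrow fun k f => P (x k) f * W f (x k) (y k)).symm
    have hWn : ∀ f : Fin n → F, IsPMF fun y : Fin n → Y => ∏ k, W (f k) (x k) (y k) :=
      fun f => IsPMF.prod_arrow fun k => hW (f k) (x k)
    exact exists_codebook (ι := ι) (IsPMF.prod_arrow fun k => hP (x k)) hWn hQn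
      (Real.exp_pos (n * m)).le (half_pos hε)
  choose c hc using hone
  refine ⟨fun i x => c x i, ?_⟩
  have hπn : IsPMF fun x : Fin n → X => ∏ k, π (x k) := IsPMF.prod_arrow fun _ => hπ
  have hbad : ∑ x : Fin n → X, (∏ k, π (x k)) * bad x ≤ ρ ^ n := by
    refine le_trans (le_of_eq ?_) (hρ n)
    rw [sum_arrow_prod fun (x : Fin n → X) (fy : Fin n → F × Y) =>
      (∏ k, (π (x k) * P (x k) (fy k).1 * W (fy k).1 (x k) (fy k).2)) *
      (if Real.exp (n * m) * ∏ k, Q (x k) (fy k).2 < ∏ k, W (fy k).1 (x k) (fy k).2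
        then (1 : ℝ) else 0)]
    refine Finset.sum_congr rfl fun x _ => ?_
    rw [sum_arrow_prod fun (f : Fin n → F) (y : Fin n → Y) =>
      (∏ k, (π (x k) * P (x k) (f k) * W (f k) (x k) (y k))) *
      (if Real.exp (n * m) * ∏ k, Q (x k) (y k) < ∏ k, W (f k) (x k) (y k)
        then (1 : ℝ) else 0)]
    simp only [bad, Finset.mul_sum, Finset.prod_mul_distrib, mul_assoc]
  have hcov : Real.exp (n * m) / (2 * Fintype.card ι * (ε / 2)) ≤ ε / 4 := by
    refine le_trans ?_ b1.le
    have hE := Real.exp_pos (n * R)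
    have : Real.exp (m - R) ^ n = Real.exp (n * m) / Real.exp (n * R) := by
      rw [← Real.exp_nat_mul, ← Real.exp_sub]; ring_nf
    rw [this]
    calc Real.exp (n * m) / (2 * Fintype.card ι * (ε / 2))
        ≤ Real.exp (n * m) / (2 * (Real.exp (n * R) / 4) * (ε / 2)) := by gcongr
      _ = _ := by field_simp
  calc _ ≤ ∑ x : Fin n → X, (∏ k, π (x k)) *
        ((ε / 2) / 2 + Real.exp (n * m) / (2 * Fintype.card ι * (ε / 2)) + 2 * bad x) :=
        Finset.sum_le_sum fun x _ => mul_le_mul_of_nonneg_left (hc x) (hπn.1 x)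
    _ = (ε / 2) / 2 + Real.exp (n * m) / (2 * Fintype.card ι * (ε / 2)) +
        2 * ∑ x : Fin n → X, (∏ k, π (x k)) * bad x := by
        have := hπn.2
        simp only [mul_add, Finset.sum_add_distrib, ← Finset.sum_mul, this, one_mul,
          Finset.mul_sum, mul_left_comm (2 : ℝ)]
    _ ≤ ε := by linarith

end LargeDeviations

section Protocol

theorem IsPMF.prod [Fintype α] [Fintype β] {a : α → ℝ} {b : β → ℝ} (ha : IsPMF a)
    (hb : IsPMF b) : IsPMF fun ω : α × β => a ω.1 * b ω.2 :=
  ⟨fun ω => mul_nonneg (ha.1 _) (hb.1 _), by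
    simp only [Fintype.sum_prod_type, ← Finset.mul_sum, hb.2, mul_one, ha.2]⟩

theorem distr_comp [Fintype Ω] [Fintype α] [DecidableEq α] [DecidableEq β] (μ : Ω → ℝ)
    (X : Ω → α) (f : α → β) : distr μ (fun ω => f (X ω)) = distr (distr μ X) f := by
  funext b
  have h := sum_distr_mul μ X fun a => if f a = b then 1 else 0
  simp only [mul_ite, mul_one, mul_zero] at h
  simpa only [distr] using h.symm

theorem distr_apply_of_injective [Fintype Ω] [DecidableEq α] (μ : Ω → ℝ) {X : Ω → α}
    (hX : Function.Injective X) (ω : Ω) : distr μ X (X ω) = μ ω := by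
  classical
  simp [distr, hX.eq_iff]

theorem isPMF_const_card {N : ℕ} (hN : 0 < N) : IsPMF fun _ : Fin N => (1 / N : ℝ) :=
  ⟨fun _ => by positivity, by simp [hN.ne']⟩

theorem distr_fst_mul [Fintype α] [Fintype β] [DecidableEq α] (a : α → ℝ) {b : β → ℝ}
    (hb : IsPMF b) : distr (fun ω : α × β => a ω.1 * b ω.2) Prod.fst = a := by
  funext x
  simp only [distr, Fintype.sum_prod_type]
  rw [Finset.sum_eq_single x (fun x' _ hx => by simp [hx]) (by simp)]
  simp [← Finset.mul_sum, hb.2]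

theorem distr_snd_mul [Fintype α] [Fintype β] [DecidableEq β] {a : α → ℝ} (ha : IsPMF a)
    (b : β → ℝ) : distr (fun ω : α × β => a ω.1 * b ω.2) Prod.snd = b := by
  funext x
  simp only [distr, Fintype.sum_prod_type_right]
  rw [Finset.sum_eq_single x (fun x' _ hx => by simp [hx]) (by simp)]
  simp [← Finset.sum_mul, ha.2]

theorem entFun_const_card {N : ℕ} (hN : 0 < N) :
    entFun (fun _ : Fin N => (1 / N : ℝ)) = Real.logb 2 N := by
  have : (N : ℝ) ≠ 0 := by exact_mod_cast hN.ne'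
  simp [entFun, this]

/-- Every stochastic kernel is a random function driven by independent randomness. -/
theorem exists_functional_representation {A B : Type} [Fintype A] [DecidableEq A] [Fintype B]
    [DecidableEq B] {K : A → B → ℝ} (hK : ∀ a, IsPMF (K a)) :
    ∃ (U : Type) (_ : Fintype U) (_ : DecidableEq U) (ν : U → ℝ) (g : U → A → B), IsPMF ν ∧
      ∀ a b, ∑ u, ν u * (if g u a = b then 1 else 0) = K a b := by
  refine ⟨A → B, inferInstance, inferInstance, fun u => ∏ a, K a (u a), id,
    IsPMF.prod_arrow hK, fun a b => ?_⟩
  refine (sum_prod_mul_apply (fun a => (hK a).2) (fun z => if z = b then 1 else 0) a).trans ?_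
  simp

/-- Two nodes observing a common source and exchanging uniformly distributed indices realise the
output distribution obtained by averaging a product of local kernels over the indices. -/
theorem admissible_two_of_kernels {𝒳 : Type} [Fintype 𝒳] [DecidableEq 𝒳]
    [Fintype 𝒴₁] [DecidableEq 𝒴₁] [Fintype 𝒴₂] [DecidableEq 𝒴₂]
    (q : 𝒳 × 𝒳 × 𝒴₁ × 𝒴₂ → ℝ)
    (hdiag : ∀ x₁ x₂, x₁ ≠ x₂ → ∀ y₁ y₂, q (x₁, x₂, y₁, y₂) = 0)
    {π : 𝒳 → ℝ} (hπ : IsPMF π) (hsrc : ∀ x, srcMarg q (x, x) = π x) (R₁ R₂ : ℝ)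
    (h : ∀ ε : ℝ, 0 < ε → ∃ n₀ : ℕ, ∀ n : ℕ, n₀ ≤ n → ∃ N₁ N₂ : ℕ, 0 < N₁ ∧ 0 < N₂ ∧
      Real.logb 2 N₁ ≤ n * R₁ ∧ Real.logb 2 N₂ ≤ n * R₂ ∧
      ∃ (K₁ : Fin N₁ × Fin N₂ → (Fin n → 𝒳) → (Fin n → 𝒴₁) → ℝ)
        (K₂ : Fin N₁ × Fin N₂ → (Fin n → 𝒳) → (Fin n → 𝒴₂) → ℝ),
        (∀ i x, IsPMF (K₁ i x)) ∧ (∀ i x, IsPMF (K₂ i x)) ∧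
        ∑ x : Fin n → 𝒳, ∑ y₁, ∑ y₂,
          |(∏ k, π (x k)) * ((∑ i, K₁ i x y₁ * K₂ i x y₂) / (N₁ * N₂)) -
            ∏ k, q (x k, x k, y₁ k, y₂ k)| ≤ ε) :
    Admissible q 2 R₁ R₂ := by
  intro ε hε
  obtain ⟨n₀, hn₀⟩ := h ε hε
  refine ⟨n₀, fun n hn => ?_⟩
  obtain ⟨N₁, N₂, hN₁, hN₂, hR₁, hR₂, K₁, K₂, hK₁, hK₂, hdist⟩ := hn₀ n hn
  let a : (Fin n → 𝒳) → ℝ := fun x => ∏ k, π (x k)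
  have ha : IsPMF a := IsPMF.prod_arrow fun _ => hπ
  obtain ⟨U₁, _, _, ν₁, g₁, hν₁, hν₁K⟩ := exists_functional_representation
    (K := fun j : (Fin N₁ × Fin N₂) × (Fin n → 𝒳) => K₁ j.1 j.2) fun j => hK₁ j.1 j.2
  obtain ⟨U₂, _, _, ν₂, g₂, hν₂, hν₂K⟩ := exists_functional_representation
    (K := fun j : (Fin N₁ × Fin N₂) × (Fin n → 𝒳) => K₂ j.1 j.2) fun j => hK₂ j.1 j.2
  let b₁ : Fin N₁ × U₁ → ℝ := fun m => 1 / N₁ * ν₁ m.2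
  let b₂ : Fin N₂ × U₂ → ℝ := fun m => 1 / N₂ * ν₂ m.2
  have hb₁ : IsPMF b₁ := (isPMF_const_card hN₁).prod hν₁
  have hb₂ : IsPMF b₂ := (isPMF_const_card hN₂).prod hν₂
  let Ω₀ := (Fin n → 𝒳) × (Fin N₁ × U₁) × (Fin N₂ × U₂)
  let μ : Ω₀ → ℝ := fun ω => a ω.1 * (b₁ ω.2.1 * b₂ ω.2.2)
  have hμ : IsPMF μ := ha.prod (hb₁.prod hb₂)
  have dX : distr μ (fun ω : Ω₀ => ω.1) = a := distr_fst_mul a (hb₁.prod hb₂)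
  have dM : distr μ (fun ω : Ω₀ => ω.2) =
      fun m => b₁ m.1 * b₂ m.2 :=
    distr_snd_mul ha fun m : (Fin N₁ × U₁) × (Fin N₂ × U₂) => b₁ m.1 * b₂ m.2
  have dM₁ : distr μ (fun ω : Ω₀ => ω.2.1) = b₁ := by
    rw [distr_comp μ (fun ω : Ω₀ => ω.2) Prod.fst, dM, distr_fst_mul b₁ hb₂]
  have dM₂ : distr μ (fun ω : Ω₀ => ω.2.2) = b₂ := by
    rw [distr_comp μ (fun ω : Ω₀ => ω.2) Prod.snd, dM, distr_snd_mul hb₁ b₂]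
  have dXX : distr μ (fun ω : Ω₀ => (ω.1, ω.1)) = fun x => if x.1 = x.2 then a x.1 else 0 := by
    rw [distr_comp μ (fun ω : Ω₀ => ω.1) (fun x => (x, x)), dX]
    funext x
    by_cases hx : x.1 = x.2
    · rw [if_pos hx]
      have : x = (fun z => (z, z)) x.1 := Prod.ext rfl hx.symm
      conv_lhs => rw [this]
      exact distr_apply_of_injective a (fun _ _ h => (Prod.ext_iff.1 h).1) x.1
    · rw [if_neg hx]
      refine Finset.sum_eq_zero fun z _ => if_neg fun hz => hx ?_
      rw [← hz]
  let C : Fin 2 → Ω₀ → Fin N₁ ⊕ Fin N₂ :=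
    fun i ω => if i = 0 then Sum.inl ω.2.1.1 else Sum.inr ω.2.2.1
  have hC₁ : H μ (C 0) = Real.logb 2 N₁ := by
    rw [← entFun_const_card hN₁]
    refine (H_comp_of_injective μ (fun ω : Ω₀ => ω.2.1.1) Sum.inl_injective).trans ?_
    rw [H, distr_comp μ (fun ω : Ω₀ => ω.2.1) Prod.fst, dM₁]
    exact congrArg entFun (distr_fst_mul (fun _ : Fin N₁ => (1 / N₁ : ℝ)) hν₁)
  have hC₂ : H μ (C 1) = Real.logb 2 N₂ := by
    rw [← entFun_const_card hN₂]
    refine (H_comp_of_injective μ (fun ω : Ω₀ => ω.2.2.1) Sum.inr_injective).trans ?_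
    rw [H, distr_comp μ (fun ω : Ω₀ => ω.2.2) Prod.fst, dM₂]
    exact congrArg entFun (distr_fst_mul (fun _ : Fin N₂ => (1 / N₂ : ℝ)) hν₂)
  let Y₁ : Ω₀ → Fin n → 𝒴₁ := fun ω => g₁ ω.2.1.2 ((ω.2.1.1, ω.2.2.1), ω.1)
  let Y₂ : Ω₀ → Fin n → 𝒴₂ := fun ω => g₂ ω.2.2.2 ((ω.2.1.1, ω.2.2.1), ω.1)
  have hY : ∀ x₁ x₂ y₁ y₂, distr μ (fun ω => (ω.1, ω.1, Y₁ ω, Y₂ ω)) (x₁, x₂, y₁, y₂) =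
      if x₁ = x₂ then a x₁ * ((∑ i, K₁ i x₁ y₁ * K₂ i x₁ y₂) / (N₁ * N₂)) else 0 := by
    intro x₁ x₂ y₁ y₂
    split_ifs with hx
    · subst hx
      rw [distr, Fintype.sum_prod_type,
        Finset.sum_eq_single x₁ (fun x _ hx => by simp [hx]) (by simp),
        Fintype.sum_prod_type, Fintype.sum_prod_type, Fintype.sum_prod_type, Finset.sum_div,
        Finset.mul_sum]
      refine Finset.sum_congr rfl fun c₁ _ => ?_
      simp only [Fintype.sum_prod_type]
      rw [Finset.sum_comm, Finset.sum_div, Finset.mul_sum]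
      refine Finset.sum_congr rfl fun c₂ _ => ?_
      rw [← hν₁K ((c₁, c₂), x₁) y₁, ← hν₂K ((c₁, c₂), x₁) y₂, Finset.sum_mul_sum,
        Finset.sum_div, Finset.mul_sum]
      refine Finset.sum_congr rfl fun u₁ _ => ?_
      rw [Finset.sum_div, Finset.mul_sum]
      refine Finset.sum_congr rfl fun u₂ _ => ?_
      simp only [μ, b₁, b₂, Y₁, Y₂, Prod.mk.injEq, true_and]
      by_cases h1 : g₁ u₁ ((c₁, c₂), x₁) = y₁ <;> by_cases h2 : g₂ u₂ ((c₁, c₂), x₁) = y₂ <;>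
        simp only [h1, h2, and_true, and_false, if_true, if_false, mul_zero, zero_mul, mul_one,
          zero_div]
      field_simp
    · refine Finset.sum_eq_zero fun ω _ => if_neg fun hz => hx ?_
      simp only [Prod.mk.injEq] at hz
      exact hz.1.symm.trans hz.2.1
  refine ⟨Ω₀, Fin N₁ × U₁, Fin N₂ × U₂, fun _ => Fin N₁ ⊕ Fin N₂,
    inferInstance, inferInstance, inferInstance, inferInstance, inferInstance, inferInstance,
    inferInstance, inferInstance, μ, fun ω => ω.1, fun ω => ω.1, fun ω => ω.2.1, fun ω => ω.2.2,
    C, Y₁, Y₂, hμ, ?_, ?_, ?_, ?_, ?_, ?_, ?_, ?_, ?_⟩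
  · rw [dXX]
    funext x
    split_ifs with hx
    · simp only [a, ← hx, hsrc]
    · obtain ⟨k, hk⟩ := Function.ne_iff.1 hx
      refine (Finset.prod_eq_zero (Finset.mem_univ k) ?_).symm
      simp only [srcMarg, hdiag _ _ hk, Finset.sum_const_zero]
  · rw [dM₁, dM₂, dXX]
    funext m
    obtain ⟨m₁, m₂, x₁, x₂⟩ := m
    simp only
    split_ifs with hx
    · subst hx
      refine (distr_apply_of_injective μ (X := fun ω : Ω₀ => (ω.2.1, ω.2.2, ω.1, ω.1))
        (fun ω ω' h => ?_) (x₁, m₁, m₂)).trans ?_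
      · simp only [Prod.mk.injEq] at h
        exact Prod.ext h.2.2.1 (Prod.ext h.1 h.2.1)
      · simp only [μ]
        ring
    · rw [mul_zero]
      refine Finset.sum_eq_zero fun ω _ => if_neg fun hz => hx ?_
      simp only [Prod.mk.injEq] at hz
      exact hz.2.2.1.symm.trans hz.2.2.2
  · intro i hi
    have hi0 : i = 0 := by omega
    subst hi0
    exact condEnt_eq_zero_of_function μ _ _ (fun z => Sum.inl z.2.2.1) fun ω => rfl
  · intro i hi
    have hi1 : i = 1 := by omega
    subst hi1
    exact condEnt_eq_zero_of_function μ _ _ (fun z => Sum.inr z.2.2.1) fun ω => rfl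
  · have : Finset.univ.filter (fun i : Fin 2 => (i : ℕ) % 2 = 0) = {0} := by decide
    rw [this, Finset.sum_singleton, hC₁]
    exact hR₁
  · have : Finset.univ.filter (fun i : Fin 2 => (i : ℕ) % 2 = 1) = {1} := by decide
    rw [this, Finset.sum_singleton, hC₂]
    exact hR₂
  · exact condEnt_eq_zero_of_function μ _ _
      (fun z => g₁ z.2.1.2 ((z.2.1.1, Sum.elim (fun _ => ⟨0, hN₂⟩) id (z.2.2 1)), z.1))
      fun ω => rfl
  · exact condEnt_eq_zero_of_function μ _ _
      (fun z => g₂ z.2.1.2 ((Sum.elim id (fun _ => ⟨0, hN₁⟩) (z.2.2 0), z.2.1.1), z.1))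
      fun ω => rfl
  · refine le_trans (le_of_eq ?_) hdist
    rw [l1dist, Fintype.sum_prod_type]
    refine Finset.sum_congr rfl fun x _ => ?_
    rw [Fintype.sum_prod_type, Finset.sum_eq_single x]
    · simp only [Fintype.sum_prod_type, hY, if_true, a]
    · intro x' _ hx
      obtain ⟨k, hk⟩ := Function.ne_iff.1 hx.symm
      refine Finset.sum_eq_zero fun y _ => ?_
      rw [hY, if_neg hx.symm, zero_sub, abs_neg, abs_eq_zero]
      exact Finset.prod_eq_zero (Finset.mem_univ k) (hdiag _ _ hk _ _)
    · simp

end Protocol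

section CommonDescription

variable {F X : Type} [Fintype F] [DecidableEq F] [Fintype X] [DecidableEq X]
  [Fintype 𝒴₁] [DecidableEq 𝒴₁] [Fintype 𝒴₂] [DecidableEq 𝒴₂]

/-- A joint pmf under which `Y¹ – (F, X) – Y²` factors into a source, a description kernel, and
two local output kernels. -/
theorem exists_factorization {p : F × X × 𝒴₁ × 𝒴₂ → ℝ} (hp : IsPMF p)
    (hMarkov : cmi p (fun a => a.2.2.1) (fun a => a.2.2.2) (fun a => (a.1, a.2.1)) = 0) :
    ∃ (π : X → ℝ) (P : X → F → ℝ) (W₁ : F → X → 𝒴₁ → ℝ) (W₂ : F → X → 𝒴₂ → ℝ),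
      IsPMF π ∧ (∀ x, IsPMF (P x)) ∧ (∀ f x, IsPMF (W₁ f x)) ∧ (∀ f x, IsPMF (W₂ f x)) ∧
      ∀ f x y₁ y₂, p (f, x, y₁, y₂) = π x * P x f * (W₁ f x y₁ * W₂ f x y₂) := by
  obtain ⟨⟨f₀, x₀, y₁₀, y₂₀⟩⟩ : Nonempty (F × X × 𝒴₁ × 𝒴₂) := by
    by_contra h
    rw [not_nonempty_iff] at h
    have := hp.2
    simp at this
  have : Nonempty F := ⟨f₀⟩
  have : Nonempty 𝒴₁ := ⟨y₁₀⟩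
  have : Nonempty 𝒴₂ := ⟨y₂₀⟩
  let J : X → F → ℝ := fun x f => ∑ y₁, ∑ y₂, p (f, x, y₁, y₂)
  have hJ : ∀ x f, 0 ≤ J x f := fun x f =>
    Finset.sum_nonneg fun _ _ => Finset.sum_nonneg fun _ _ => hp.1 _
  obtain ⟨P, hP, hJP⟩ := exists_kernel J hJ
  obtain ⟨W₁, hW₁, hJW₁⟩ := exists_kernel
    (fun (a : F × X) y₁ => ∑ y₂, p (a.1, a.2, y₁, y₂))
    (fun _ _ => Finset.sum_nonneg fun _ _ => hp.1 _)
  obtain ⟨W₂, hW₂, hJW₂⟩ := exists_kernel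
    (fun (a : F × X) y₂ => ∑ y₁, p (a.1, a.2, y₁, y₂))
    (fun _ _ => Finset.sum_nonneg fun _ _ => hp.1 _)
  refine ⟨fun x => ∑ f, J x f, P, fun f x => W₁ (f, x), fun f x => W₂ (f, x),
    ⟨fun x => Finset.sum_nonneg fun f _ => hJ x f, ?_⟩, hP, fun f x => hW₁ (f, x),
    fun f x => hW₂ (f, x), fun f x y₁ y₂ => ?_⟩
  · rw [Finset.sum_comm, ← hp.2]
    simp only [J, Fintype.sum_prod_type]
  · have h := distr_mul_distr_of_cmi_eq_zero hp.1 _ _ _ hMarkov y₁ y₂ (f, x)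
    have e1 : distr p (fun a => (a.2.2.1, a.2.2.2, a.1, a.2.1)) (y₁, y₂, f, x) =
        p (f, x, y₁, y₂) := by
      refine distr_apply_of_injective p (X := fun a : F × X × 𝒴₁ × 𝒴₂ =>
        (a.2.2.1, a.2.2.2, a.1, a.2.1)) (fun a b hab => ?_) (f, x, y₁, y₂)
      simp only [Prod.mk.injEq] at hab
      exact Prod.ext hab.2.2.1 (Prod.ext hab.2.2.2 (Prod.ext hab.1 hab.2.1))
    have e2 : distr p (fun a => (a.1, a.2.1)) (f, x) = J x f := by
      simp only [distr, Fintype.sum_prod_type, Prod.mk.injEq]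
      rw [Finset.sum_eq_single f (fun f' _ hf => by simp [hf]) (by simp),
        Finset.sum_eq_single x (fun x' _ hx => by simp [hx]) (by simp)]
      simp [J]
    have e3 : distr p (fun a => (a.2.2.1, a.1, a.2.1)) (y₁, f, x) =
        ∑ y₂, p (f, x, y₁, y₂) := by
      simp only [distr, Fintype.sum_prod_type, Prod.mk.injEq]
      rw [Finset.sum_eq_single f (fun f' _ hf => by simp [hf]) (by simp),
        Finset.sum_eq_single x (fun x' _ hx => by simp [hx]) (by simp),
        Finset.sum_eq_single y₁ (fun y' _ hy => by simp [hy]) (by simp)]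
      simp
    have e4 : distr p (fun a => (a.2.2.2, a.1, a.2.1)) (y₂, f, x) =
        ∑ y₁, p (f, x, y₁, y₂) := by
      simp only [distr, Fintype.sum_prod_type, Prod.mk.injEq]
      rw [Finset.sum_eq_single f (fun f' _ hf => by simp [hf]) (by simp),
        Finset.sum_eq_single x (fun x' _ hx => by simp [hx]) (by simp)]
      refine Finset.sum_congr rfl fun y _ => ?_
      rw [Finset.sum_eq_single y₂ (fun y' _ hy => by simp [hy]) (by simp)]
      simp
    have k1 : ∑ y₂, p (f, x, y₁, y₂) = J x f * W₁ (f, x) y₁ := hJW₁ (f, x) y₁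
    have k2 : ∑ y₁, p (f, x, y₁, y₂) = J x f * W₂ (f, x) y₂ := by
      rw [hJW₂ (f, x) y₂, Finset.sum_comm]
    rw [e1, e2, e3, e4, k1, k2] at h
    rw [← hJP x f]
    rcases eq_or_ne (J x f) 0 with h0 | h0
    · have h1 := (Finset.sum_eq_zero_iff_of_nonneg fun y₁ _ =>
        Finset.sum_nonneg fun y₂ _ => hp.1 (f, x, y₁, y₂)).1 h0 y₁ (Finset.mem_univ _)
      have h2 := (Finset.sum_eq_zero_iff_of_nonneg fun y₂ _ => hp.1 (f, x, y₁, y₂)).1 h1 y₂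
        (Finset.mem_univ _)
      rw [h2, h0, zero_mul]
    · refine mul_right_cancel₀ h0 (h.trans ?_)
      ring

theorem cmi_eq_sum_kernel {Y : Type*} [Fintype Y] [DecidableEq Y] {p : F × X × Y → ℝ}
    (hp : IsPMF p) {π : X → ℝ} {P : X → F → ℝ} (hP : ∀ x, IsPMF (P x))
    {W : F → X → Y → ℝ} (hW : ∀ f x, IsPMF (W f x))
    (hfac : ∀ f x y, p (f, x, y) = π x * P x f * W f x y) :
    Real.log 2 * cmi p (fun a => a.2.2) (fun a => a.1) (fun a => a.2.1) =
      ∑ x, ∑ f, ∑ y, π x * P x f * W f x y *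
        Real.log (W f x y / ∑ f', P x f' * W f' x y) := by
  have d1 : ∀ f x y, distr p (fun a => (a.2.2, a.1, a.2.1)) (y, f, x) = p (f, x, y) :=
    fun f x y => by
      refine distr_apply_of_injective p (X := fun a : F × X × Y => (a.2.2, a.1, a.2.1))
        (fun a b hab => ?_) (f, x, y)
      simp only [Prod.mk.injEq] at hab
      exact Prod.ext hab.2.1 (Prod.ext hab.2.2 hab.1)
  have d2 : ∀ x, distr p (fun a => a.2.1) x = π x := fun x => by
    simp only [distr, Fintype.sum_prod_type]
    have : ∀ f, ∑ x', ∑ y, (if x' = x then p (f, x', y) else 0) = π x * P x f := fun f => by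
      rw [Finset.sum_eq_single x (fun x' _ hx => by simp [hx]) (by simp)]
      simp [hfac, ← Finset.mul_sum, (hW f x).2]
    simp only [this, ← Finset.mul_sum, (hP x).2, mul_one]
  have d3 : ∀ f x, distr p (fun a => (a.1, a.2.1)) (f, x) = π x * P x f := fun f x => by
    simp only [distr, Fintype.sum_prod_type, Prod.mk.injEq]
    rw [Finset.sum_eq_single f (fun f' _ hf => by simp [hf]) (by simp),
      Finset.sum_eq_single x (fun x' _ hx => by simp [hx]) (by simp)]
    simp [hfac, ← Finset.mul_sum, (hW f x).2]
  have d4 : ∀ x y, distr p (fun a => (a.2.2, a.2.1)) (y, x) =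
      π x * ∑ f, P x f * W f x y := fun x y => by
    simp only [distr, Fintype.sum_prod_type, Prod.mk.injEq, Finset.mul_sum]
    refine Finset.sum_congr rfl fun f _ => ?_
    rw [Finset.sum_eq_single x (fun x' _ hx => by simp [hx]) (by simp),
      Finset.sum_eq_single y (fun y' _ hy => by simp [hy]) (by simp)]
    simp [hfac, mul_assoc]
  rw [cmi_eq_sum hp.1, Finset.mul_sum, Fintype.sum_prod_type, Finset.sum_congr rfl fun _ _ =>
    Fintype.sum_prod_type _, Finset.sum_comm]
  refine Finset.sum_congr rfl fun x _ => Finset.sum_congr rfl fun f _ =>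
    Finset.sum_congr rfl fun y _ => ?_
  simp only [d1, d2, d3, d4]
  rw [hfac]
  rcases eq_or_ne (π x * P x f * W f x y) 0 with h0 | h0
  · simp [h0]
  · have hπx : π x ≠ 0 := fun h => h0 (by simp [h])
    have hPx : P x f ≠ 0 := fun h => h0 (by simp [h])
    have : π x * P x f * W f x y * π x / (π x * (∑ f, P x f * W f x y) * (π x * P x f)) =
        W f x y / ∑ f', P x f' * W f' x y := by
      have : π x * P x f * W f x y * π x / (π x * (∑ f, P x f * W f x y) * (π x * P x f)) =
          (π x * π x * P x f) * W f x y / ((π x * π x * P x f) * ∑ f', P x f' * W f' x y) := by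
        congr 1 <;> ring
      rw [this, mul_div_mul_left _ _ (by positivity)]
    rw [this, Real.logb]
    have : Real.log 2 ≠ 0 := (Real.log_pos one_lt_two).ne'
    field_simp

theorem exists_nat_rpow_half_le {z : ℝ} (hz : 0 ≤ z) :
    ∃ N : ℕ, 0 < N ∧ Real.logb 2 N ≤ z ∧ (2 : ℝ) ^ z / 2 ≤ N := by
  have h1 : (1 : ℝ) ≤ 2 ^ z := Real.one_le_rpow one_le_two hz
  have hN : 1 ≤ ⌊(2 : ℝ) ^ z⌋₊ := Nat.le_floor (by exact_mod_cast h1)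
  have hN' : (1 : ℝ) ≤ ⌊(2 : ℝ) ^ z⌋₊ := by exact_mod_cast hN
  refine ⟨⌊(2 : ℝ) ^ z⌋₊, hN, ?_, ?_⟩
  · rw [Real.logb_le_iff_le_rpow one_lt_two (by linarith)]
    exact Nat.floor_le (by linarith)
  · linarith [Nat.lt_floor_add_one ((2 : ℝ) ^ z)]

/-- Coordination with a common source through a single description `F` satisfying
`Y¹ – (F, X) – Y²`: the sum rate only needs to exceed `I(Y¹,Y²; F | X)`. -/
theorem admissible_of_common_description (q : X × X × 𝒴₁ × 𝒴₂ → ℝ)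
    (hdiag : ∀ x₁ x₂, x₁ ≠ x₂ → ∀ y₁ y₂, q (x₁, x₂, y₁, y₂) = 0)
    {p : F × X × 𝒴₁ × 𝒴₂ → ℝ} (hp : IsPMF p)
    (hmarg : ∀ x y₁ y₂, (∑ f, p (f, x, y₁, y₂)) = q (x, x, y₁, y₂))
    (hMarkov : cmi p (fun a => a.2.2.1) (fun a => a.2.2.2) (fun a => (a.1, a.2.1)) = 0)
    {R₁ R₂ : ℝ} (hR₁ : 0 ≤ R₁) (hR₂ : 0 ≤ R₂)
    (hrate : Subsingleton F ∨
      cmi p (fun a => a.2.2) (fun a => a.1) (fun a => a.2.1) < R₁ + R₂) :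
    Admissible q 2 R₁ R₂ := by
  obtain ⟨π, P, W₁, W₂, hπ, hP, hW₁, hW₂, hfac⟩ := exists_factorization hp hMarkov
  let W : F → X → 𝒴₁ × 𝒴₂ → ℝ := fun f x y => W₁ f x y.1 * W₂ f x y.2
  have hW : ∀ f x, IsPMF (W f x) := fun f x => (hW₁ f x).prod (hW₂ f x)
  let Q : X → 𝒴₁ × 𝒴₂ → ℝ := fun x y => ∑ f, P x f * W f x y
  have hq : ∀ x y₁ y₂, q (x, x, y₁, y₂) = π x * Q x (y₁, y₂) := fun x y₁ y₂ => by
    simp only [← hmarg, hfac, Q, W, Finset.mul_sum, mul_assoc]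
  have hQ1 : ∀ x, ∑ y₁, ∑ y₂, Q x (y₁, y₂) = 1 := fun x => by
    rw [← Fintype.sum_prod_type (Q x)]
    simp only [Q]
    rw [Finset.sum_comm]
    simp only [← Finset.mul_sum, (hW _ _).2, mul_one, (hP x).2]
  have hsrc : ∀ x, srcMarg q (x, x) = π x := fun x => by
    simp only [srcMarg, hq, ← Finset.mul_sum, hQ1, mul_one]
  suffices h : ∀ ε : ℝ, 0 < ε → ∃ n₀ : ℕ, ∀ n : ℕ, n₀ ≤ n → ∃ N₁ N₂ : ℕ, 0 < N₁ ∧ 0 < N₂ ∧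
      Real.logb 2 N₁ ≤ n * R₁ ∧ Real.logb 2 N₂ ≤ n * R₂ ∧
      ∃ c : Fin N₁ × Fin N₂ → (Fin n → X) → (Fin n → F),
        ∑ x : Fin n → X, (∏ k, π (x k)) * ∑ y : Fin n → 𝒴₁ × 𝒴₂,
          |(∑ i, ∏ k, W (c i x k) (x k) (y k)) / (N₁ * N₂) - ∏ k, Q (x k) (y k)| ≤ ε by
    refine admissible_two_of_kernels q hdiag hπ hsrc R₁ R₂ fun ε hε => ?_
    obtain ⟨n₀, hn₀⟩ := h ε hε
    refine ⟨n₀, fun n hn => ?_⟩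
    obtain ⟨N₁, N₂, h1, h2, h3, h4, c, hc⟩ := hn₀ n hn
    refine ⟨N₁, N₂, h1, h2, h3, h4, fun i x y => ∏ k, W₁ (c i x k) (x k) (y k),
      fun i x y => ∏ k, W₂ (c i x k) (x k) (y k), fun i x => IsPMF.prod_arrow fun k => hW₁ _ _,
      fun i x => IsPMF.prod_arrow fun k => hW₂ _ _, le_trans (le_of_eq ?_) hc⟩
    refine Finset.sum_congr rfl fun x _ => ?_
    rw [← sum_arrow_prod fun (y₁ : Fin n → 𝒴₁) (y₂ : Fin n → 𝒴₂) =>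
      |(∏ k, π (x k)) * ((∑ i, (∏ k, W₁ (c i x k) (x k) (y₁ k)) *
        ∏ k, W₂ (c i x k) (x k) (y₂ k)) / (N₁ * N₂)) - ∏ k, q (x k, x k, y₁ k, y₂ k)|,
      Finset.mul_sum]
    refine Finset.sum_congr rfl fun y _ => ?_
    have hπ0 : 0 ≤ ∏ k, π (x k) := Finset.prod_nonneg fun k _ => hπ.1 _
    simp only [hq, Finset.prod_mul_distrib, ← mul_sub, abs_mul, abs_of_nonneg hπ0, W]
  rcases hrate with hF | hrate
  · intro ε hε
    refine ⟨0, fun n _ => ⟨1, 1, one_pos, one_pos, ?_, ?_, ?_⟩⟩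
    · simp only [Nat.cast_one, Real.logb_one]; positivity
    · simp only [Nat.cast_one, Real.logb_one]; positivity
    · have : Nonempty F := by
        by_contra h
        rw [not_nonempty_iff] at h
        have := hp.2
        simp at this
      let f₀ : F := Classical.arbitrary F
      have huniv : (Finset.univ : Finset F) = {f₀} :=
        Finset.eq_singleton_iff_unique_mem.2 ⟨Finset.mem_univ _, fun f _ => Subsingleton.elim _ _⟩
      have hP1 : ∀ x, P x f₀ = 1 := fun x => by
        have := (hP x).2
        rwa [huniv, Finset.sum_singleton] at this
      have hQW : ∀ x y, Q x y = W f₀ x y := fun x y => by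
        simp only [Q, huniv, Finset.sum_singleton, hP1, one_mul]
      refine ⟨fun _ _ _ => f₀, ?_⟩
      simp [hQW, hε.le]
  · intro ε hε
    have hlog2 : 0 < Real.log 2 := Real.log_pos one_lt_two
    have hR : ∑ x, ∑ f, ∑ y, π x * P x f * W f x y * Real.log (W f x y / Q x y) <
        Real.log 2 * (R₁ + R₂) := by
      rw [← cmi_eq_sum_kernel hp hP hW fun f x y => hfac f x y.1 y.2]
      exact mul_lt_mul_of_pos_left hrate hlog2
    obtain ⟨n₀, hn₀⟩ := exists_block_codebook hπ hP hW (fun _ _ => rfl) hR hε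
    refine ⟨n₀, fun n hn => ?_⟩
    obtain ⟨N₁, h1, h2, h3⟩ := exists_nat_rpow_half_le (z := n * R₁) (by positivity)
    obtain ⟨N₂, h4, h5, h6⟩ := exists_nat_rpow_half_le (z := n * R₂) (by positivity)
    have : Nonempty (Fin N₁ × Fin N₂) := ⟨(⟨0, h1⟩, ⟨0, h4⟩)⟩
    have hcard : (Fintype.card (Fin N₁ × Fin N₂) : ℝ) = N₁ * N₂ := by simp
    obtain ⟨c, hc⟩ := hn₀ n hn (Fin N₁ × Fin N₂) (by
      rw [hcard]
      have e : Real.exp (n * (Real.log 2 * (R₁ + R₂))) / 4 =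
          ((2 : ℝ) ^ (n * R₁) / 2) * ((2 : ℝ) ^ (n * R₂) / 2) := by
        rw [Real.rpow_def_of_pos two_pos, Real.rpow_def_of_pos two_pos, div_mul_div_comm,
          ← Real.exp_add]
        ring_nf
      rw [e]
      exact mul_le_mul h3 h6 (by positivity) (by positivity))
    rw [hcard] at hc
    exact ⟨N₁, N₂, h1, h4, h2, h5, c, hc⟩

end CommonDescription

/-- Theorem 4 of the paper, achievability when `X¹ = X²`. Suppose the
`(x¹,x²)`-marginal of `q` is supported on the diagonal (so we may write `X = X¹ = X²`).
Let `F₁, …, F_r` be finite-valued random variables jointly distributed with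
`(X, Y¹, Y²) ∼ q` (the joint pmf is `p` on `((i : Fin r) → 𝓕 i) × 𝒳 × 𝒴₁ × 𝒴₂`) such
that `Y¹ – (F₁,…,F_r, X) – Y²`, and let `R'₁, …, R'_r` be positive reals with
`Σ_{i=1}^s R'_i > I(Y¹,Y²; F₁,…,F_s | X)` for every `s`. Then the rate pair
`(Σ_{odd i} R'_i, Σ_{even i} R'_i)` (1-based parity; Lean index `i` has 1-based
parity `(i+1)`) is admissible with 2 rounds of communication.
Coordinates on the sample space: `a.1 = f`, `a.2.1 = x`, `a.2.2.1 = y¹`, `a.2.2.2 = y²`. -/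
theorem achievability_common_source
    {𝒳 𝒴₁ 𝒴₂ : Type}
    [Fintype 𝒳] [DecidableEq 𝒳]
    [Fintype 𝒴₁] [DecidableEq 𝒴₁] [Fintype 𝒴₂] [DecidableEq 𝒴₂]
    (q : 𝒳 × 𝒳 × 𝒴₁ × 𝒴₂ → ℝ) (hq : IsPMF q)
    (hdiag : ∀ x₁ x₂, x₁ ≠ x₂ → ∀ y₁ y₂, q (x₁, x₂, y₁, y₂) = 0)
    (r : ℕ) (𝓕 : Fin r → Type) [∀ i, Fintype (𝓕 i)] [∀ i, DecidableEq (𝓕 i)]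
    (p : ((i : Fin r) → 𝓕 i) × 𝒳 × 𝒴₁ × 𝒴₂ → ℝ) (hp : IsPMF p)
    -- p is a joint distribution for (F₁,…,F_r, X, Y¹, Y²) with (X, Y¹, Y²) ∼ q
    (hmarg : ∀ x y₁ y₂, (∑ f, p (f, x, y₁, y₂)) = q (x, x, y₁, y₂))
    -- Y¹ – (F₁,…,F_r, X) – Y²
    (hMarkov : cmi p (fun a => a.2.2.1) (fun a => a.2.2.2) (fun a => (a.1, a.2.1)) = 0)
    (R' : Fin r → ℝ) (hpos : ∀ i, 0 < R' i)
    -- Σ_{i=1}^s R'_i > I(Y¹, Y²; F₁,…,F_s | X) for every 1 ≤ s ≤ r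
    (hrate : ∀ s : Fin r,
      (∑ i ∈ Finset.univ.filter (fun i : Fin r => i ≤ s), R' i) >
        cmi p (fun a => (a.2.2.1, a.2.2.2))
          (fun a => (fun j : Fin ((s : ℕ) + 1) => a.1 ⟨j.1, lt_of_lt_of_le j.2 s.2⟩))
          (fun a => a.2.1)) :
    Admissible q 2
      (∑ i ∈ Finset.univ.filter (fun i : Fin r => (i : ℕ) % 2 = 0), R' i)
      (∑ i ∈ Finset.univ.filter (fun i : Fin r => (i : ℕ) % 2 = 1), R' i) := by
  have hsum : (∑ i ∈ Finset.univ.filter (fun i : Fin r => (i : ℕ) % 2 = 0), R' i) +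
      ∑ i ∈ Finset.univ.filter (fun i : Fin r => (i : ℕ) % 2 = 1), R' i = ∑ i, R' i := by
    rw [← Finset.sum_filter_add_sum_filter_not Finset.univ (fun i : Fin r => (i : ℕ) % 2 = 0)]
    simp only [Nat.mod_two_ne_zero]
  refine admissible_of_common_description q hdiag hp hmarg hMarkov
    (Finset.sum_nonneg fun i _ => (hpos i).le) (Finset.sum_nonneg fun i _ => (hpos i).le) ?_
  rcases Nat.eq_zero_or_pos r with rfl | hr
  · exact Or.inl inferInstance
  · refine Or.inr ?_
    have hlast : r - 1 < r := by omega
    have hs := hrate ⟨r - 1, hlast⟩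
    rw [Finset.filter_true_of_mem fun i _ => Fin.le_def.2 (Nat.le_sub_one_of_lt i.2),
      ← hsum] at hs
    refine lt_of_eq_of_lt ?_ hs
    let e : (∀ i, 𝓕 i) → ∀ j : Fin (r - 1 + 1), 𝓕 ⟨j.1, lt_of_lt_of_le j.2 hlast⟩ :=
      fun f j => f ⟨j.1, lt_of_lt_of_le j.2 hlast⟩
    have he : Function.Injective e := fun f g hfg => by
      funext i
      exact congrFun hfg ⟨i.1, by omega⟩
    have h1 := H_comp_of_injective p (fun a => (a.1, a.2.1)) (e := fun z => (e z.1, z.2))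
      fun z w hzw => Prod.ext (he (Prod.ext_iff.1 hzw).1) (Prod.ext_iff.1 hzw).2
    have h2 := H_comp_of_injective p (fun a => (a.2.2, a.1, a.2.1))
      (e := fun z => (z.1, e z.2.1, z.2.2))
      fun z w hzw => by
        simp only [Prod.mk.injEq] at hzw
        exact Prod.ext hzw.1 (Prod.ext (he hzw.2.1) hzw.2.2)
    unfold cmi
    rw [← h1, ← h2]

end Coord
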